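/- arXiv:2311.07202 — 6 statements merged into one kernel-verified Lean document; each statement's English description precedes it below -/
import Mathlib

section
/- Consider a single IC-LSTM cell step with fixed previous hidden state h_{t-1} ∈ ℝ^{n_h} and fixed previous cell state c_{t-1} ∈ ℝ^{n_h} satisfying c_{t-1} ≥ 0 entrywise. Then every component of the new hidden state h_t and of the new cell state c_t is a convex, nondecreasing (with respect to the componentwise order), and nonnegative function of the input x_t ∈ ℝ^{n_i}. -/
open Matrix

/-- A real function is convex, nondecreasing and nonnegative. -/
structure ConvexMonotoneNonneg (f : ℝ → ℝ) : Prop where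
  convexOn : ConvexOn ℝ Set.univ f
  monotone : Monotone f
  nonneg : ∀ r, 0 ≤ f r

namespace ConvexMonotoneNonneg

variable {f g : ℝ → ℝ}

theorem add (hf : ConvexMonotoneNonneg f) (hg : ConvexMonotoneNonneg g) :
    ConvexMonotoneNonneg fun r => f r + g r where
  convexOn := hf.convexOn.add hg.convexOn
  monotone := hf.monotone.add hg.monotone
  nonneg r := add_nonneg (hf.nonneg r) (hg.nonneg r)

theorem mul (hf : ConvexMonotoneNonneg f) (hg : ConvexMonotoneNonneg g) :
    ConvexMonotoneNonneg fun r => f r * g r where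
  convexOn := hf.convexOn.mul hg.convexOn (fun r _ => hf.nonneg r) (fun r _ => hg.nonneg r)
    ((hf.monotone.monovary hg.monotone).monovaryOn _)
  monotone := hf.monotone.mul hg.monotone hf.nonneg hg.nonneg
  nonneg r := mul_nonneg (hf.nonneg r) (hg.nonneg r)

theorem const {a : ℝ} (ha : 0 ≤ a) : ConvexMonotoneNonneg fun _ => a where
  convexOn := convexOn_const a convex_univ
  monotone := monotone_const
  nonneg _ := ha

theorem comp (hg : ConvexMonotoneNonneg g) (hf : ConvexOn ℝ Set.univ f) (hfm : Monotone f) :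
    ConvexMonotoneNonneg fun r => g (f r) where
  convexOn := ⟨convex_univ, fun _ hx _ hy _ _ ha hb hab =>
    (hg.monotone (hf.2 hx hy ha hb hab)).trans
      (hg.convexOn.2 (Set.mem_univ _) (Set.mem_univ _) ha hb hab)⟩
  monotone := hg.monotone.comp hfm
  nonneg r := hg.nonneg (f r)

theorem comp_affine (hg : ConvexMonotoneNonneg g) {a : ℝ} (ha : 0 ≤ a) (b : ℝ) :
    ConvexMonotoneNonneg fun r => g (a * r + b) :=
  hg.comp (((convexOn_id convex_univ).smul ha).add_const b)
    ((monotone_id.const_mul ha).add_const b)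

end ConvexMonotoneNonneg

/-- For a single IC-LSTM cell step with fixed previous hidden state
`hprev` and fixed entrywise-nonnegative previous cell state `cprev`, every component of
the new hidden state `h_t` and of the new cell state `c_t` is a convex, (componentwise)
nondecreasing and nonnegative function of the input `x_t ∈ ℝ^{n_i}`.  Here
`z = Wˣ x + Wʰ hprev`, the gates are `f = g²(Dᶠ z + bᶠ)`, `i = g²(Dⁱ z + bⁱ)`,
`o = g²(Dᵒ z + bᵒ)`, `c̃ = gᶜ(Dᶜ z + bᶜ)`, and `c = f ∗ cprev + i ∗ c̃`,
`h = o ∗ gᶜ(c)`. -/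
theorem iclstm_cell_convex_monotone_nonneg (ni nh : ℕ)
    (Wx : Matrix (Fin nh) (Fin ni) ℝ) (Wh : Matrix (Fin nh) (Fin nh) ℝ)
    (Df Di Do Dc : Fin nh → ℝ) (bf bi bo bc : Fin nh → ℝ)
    (gg gc : ℝ → ℝ)
    (hWx : ∀ i j, 0 ≤ Wx i j) (hWh : ∀ i j, 0 ≤ Wh i j)
    (hDf : ∀ j, 0 ≤ Df j) (hDi : ∀ j, 0 ≤ Di j)
    (hDo : ∀ j, 0 ≤ Do j) (hDc : ∀ j, 0 ≤ Dc j)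
    (hggcv : ConvexOn ℝ Set.univ gg) (hggm : Monotone gg) (hggn : ∀ r : ℝ, 0 ≤ gg r)
    (hgccv : ConvexOn ℝ Set.univ gc) (hgcm : Monotone gc) (hgcn : ∀ r : ℝ, 0 ≤ gc r)
    (hprev cprev : Fin nh → ℝ) (hcprev : ∀ j, 0 ≤ cprev j)
    (cnew hnew : (Fin ni → ℝ) → Fin nh → ℝ)
    (hcnew : ∀ (x : Fin ni → ℝ) (j : Fin nh),
      cnew x j =
        gg (Df j * (Wx.mulVec x + Wh.mulVec hprev) j + bf j) * cprev j +
          gg (Di j * (Wx.mulVec x + Wh.mulVec hprev) j + bi j) *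
            gc (Dc j * (Wx.mulVec x + Wh.mulVec hprev) j + bc j))
    (hhnew : ∀ (x : Fin ni → ℝ) (j : Fin nh),
      hnew x j =
        gg (Do j * (Wx.mulVec x + Wh.mulVec hprev) j + bo j) * gc (cnew x j)) :
    ∀ j : Fin nh,
      (ConvexOn ℝ Set.univ fun x : Fin ni → ℝ => hnew x j) ∧
      (Monotone fun x : Fin ni → ℝ => hnew x j) ∧
      (∀ x : Fin ni → ℝ, 0 ≤ hnew x j) ∧
      (ConvexOn ℝ Set.univ fun x : Fin ni → ℝ => cnew x j) ∧
      (Monotone fun x : Fin ni → ℝ => cnew x j) ∧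
      (∀ x : Fin ni → ℝ, 0 ≤ cnew x j) := by
  intro j
  have hgg : ConvexMonotoneNonneg gg := ⟨hggcv, hggm, hggn⟩
  have hgc : ConvexMonotoneNonneg gc := ⟨hgccv, hgcm, hgcn⟩
  let z : (Fin ni → ℝ) →ᵃ[ℝ] ℝ :=
    ((LinearMap.proj j).comp Wx.mulVecLin).toAffineMap +
      AffineMap.const ℝ (Fin ni → ℝ) (Wh.mulVec hprev j)
  have hz : Monotone z := fun x y hxy => by
    change Wx.mulVec x j + Wh.mulVec hprev j ≤ Wx.mulVec y j + Wh.mulVec hprev j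
    gcongr
    exact dotProduct_le_dotProduct_of_nonneg_left hxy (hWx j)
  have hc := ((hgg.comp_affine (hDf j) (bf j)).mul (.const (hcprev j))).add
    ((hgg.comp_affine (hDi j) (bi j)).mul (hgc.comp_affine (hDc j) (bc j)))
  have hh := (hgg.comp_affine (hDo j) (bo j)).mul (hgc.comp hc.convexOn hc.monotone)
  simp only [hhnew, hcnew]
  exact ⟨hh.convexOn.comp_affineMap z, hh.monotone.comp hz, fun x => hh.nonneg (z x),
    hc.convexOn.comp_affineMap z, hc.monotone.comp hz, fun x => hc.nonneg (z x)⟩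
end

section
/- There exist functions f, g : ℝ² → ℝ that are each convex, nonnegative, and nondecreasing with respect to the componentwise order, but whose pointwise product f · g is not convex on ℝ². Concretely, f(x, y) = max(x, 0) and g(x, y) = max(y, 0) satisfy these properties, and their product (x, y) ↦ max(x, 0)·max(y, 0) is not convex (e.g., its value at the midpoint of (1, 0) and (0, 1) exceeds the average of its values at those points). Hence nonnegative weights together with convex, nondecreasing activation functions alone do not guarantee input convexity of gated (product) architectures such as the LSTM. -/
theorem convexOn_max_coord_zero {ι : Type*} (i : ι) :
    ConvexOn ℝ Set.univ (fun x : ι → ℝ => max (x i) 0) :=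
  ((LinearMap.proj i : (ι → ℝ) →ₗ[ℝ] ℝ).convexOn convex_univ).sup
    (convexOn_const 0 convex_univ)

theorem monotone_max_coord_zero {ι : Type*} (i : ι) :
    Monotone (fun x : ι → ℝ => max (x i) 0) :=
  fun _ _ h => max_le_max_right 0 (h i)

/-- There exist convex, nonnegative, nondecreasing functions
`f, g : ℝ² → ℝ` (concretely `f (x, y) = max x 0` and `g (x, y) = max y 0`) whose
pointwise product is not convex; in particular the value of the product at the
midpoint of `(1, 0)` and `(0, 1)` exceeds the average of its values at those points. -/
theorem product_of_convex_monotone_nonneg_not_convex :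
    ∃ f g : (Fin 2 → ℝ) → ℝ,
      ConvexOn ℝ Set.univ f ∧ Monotone f ∧ (∀ x, 0 ≤ f x) ∧
      ConvexOn ℝ Set.univ g ∧ Monotone g ∧ (∀ x, 0 ≤ g x) ∧
      (∀ x, f x = max (x 0) 0) ∧ (∀ x, g x = max (x 1) 0) ∧
      ¬ ConvexOn ℝ Set.univ (fun x => f x * g x) ∧
      (1 / 2 : ℝ) * f ![(1 : ℝ), 0] * g ![(1 : ℝ), 0] +
          (1 / 2 : ℝ) * f ![(0 : ℝ), 1] * g ![(0 : ℝ), 1] <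
        f ((1 / 2 : ℝ) • ![(1 : ℝ), 0] + (1 / 2 : ℝ) • ![(0 : ℝ), 1]) *
          g ((1 / 2 : ℝ) • ![(1 : ℝ), 0] + (1 / 2 : ℝ) • ![(0 : ℝ), 1]) := by
  refine ⟨fun x => max (x 0) 0, fun x => max (x 1) 0,
    convexOn_max_coord_zero 0, monotone_max_coord_zero 0, fun _ => le_max_right _ _,
    convexOn_max_coord_zero 1, monotone_max_coord_zero 1, fun _ => le_max_right _ _,
    fun _ => rfl, fun _ => rfl, fun h => ?_, ?_⟩
  · have h_mid := h.2 (Set.mem_univ ![(1 : ℝ), 0]) (Set.mem_univ ![(0 : ℝ), 1])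
      (by norm_num : (0 : ℝ) ≤ 1 / 2) (by norm_num : (0 : ℝ) ≤ 1 / 2) (by norm_num)
    norm_num at h_mid
  · norm_num
end

section
/- Consider an input convex feedforward neural network (ICFNN) defined by the layer recursion z_{l+1} = g_l(W_l^{(z)} z_l + W_l^{(x)} x + b_l) for l = 0, 1, ..., L−1, with z_0 = 0 and W_0^{(z)} = 0, where each g_l : ℝ → ℝ is convex and nondecreasing and is applied componentwise, each W_l^{(z)} has all entries nonnegative, and the W_l^{(x)} and b_l are arbitrary. Then every component of the output z_L is a convex function of the input x. -/
open Matrix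

/-- The composition of a convex function with a nondecreasing convex function is convex. -/
theorem ConvexOn.monotone_comp_univ {E : Type*} [AddCommGroup E] [Module ℝ E]
    {f : E → ℝ} {g : ℝ → ℝ} (hg : ConvexOn ℝ Set.univ g) (hmono : Monotone g)
    (hf : ConvexOn ℝ Set.univ f) : ConvexOn ℝ Set.univ fun x => g (f x) :=
  ⟨convex_univ, fun x _ y _ _ _ ha hb hab =>
    (hmono (hf.2 (Set.mem_univ x) (Set.mem_univ y) ha hb hab)).trans
      (hg.2 (Set.mem_univ _) (Set.mem_univ _) ha hb hab)⟩

/-- A combination of convex functions with nonnegative coefficients is convex. -/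
theorem ConvexOn.dotProduct_of_nonneg {E ι : Type*} [AddCommGroup E] [Module ℝ E] [Fintype ι]
    {w : ι → ℝ} (hw : ∀ i, 0 ≤ w i) {f : E → ι → ℝ}
    (hf : ∀ i, ConvexOn ℝ Set.univ fun x => f x i) :
    ConvexOn ℝ Set.univ fun x => w ⬝ᵥ f x := by
  refine ⟨convex_univ, fun x _ y _ a c ha hc hac => ?_⟩
  simp only [← dotProduct_smul, ← dotProduct_add]
  exact Finset.sum_le_sum fun i _ =>
    mul_le_mul_of_nonneg_left ((hf i).2 (Set.mem_univ x) (Set.mem_univ y) ha hc hac) (hw i)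

/-- Each coordinate of `A f(x) + B x + b` is convex when the coordinates of `f` are convex and
`A` is entrywise nonnegative. -/
theorem ConvexOn.mulVec_add_affine {ι κ ν : Type*} [Fintype ι] [Fintype ν]
    {A : Matrix κ ι ℝ} (hA : ∀ i j, 0 ≤ A i j) (B : Matrix κ ν ℝ) (b : κ → ℝ)
    {f : (ν → ℝ) → ι → ℝ} (hf : ∀ i, ConvexOn ℝ Set.univ fun x => f x i) (j : κ) :
    ConvexOn ℝ Set.univ fun x => (A.mulVec (f x) + B.mulVec x + b) j :=
  ((ConvexOn.dotProduct_of_nonneg (hA j) hf).add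
    (((LinearMap.proj j).comp B.mulVecLin).convexOn convex_univ)).add_const (b j)

/-- For an ICFNN `z_{l+1} = g_l (W_l^{(z)} z_l + W_l^{(x)} x + b_l)`,
`l = 0, …, L-1`, with `z_0 = 0`, `W_0^{(z)} = 0`, each `g_l` convex and nondecreasing
(applied componentwise), and each `W_l^{(z)}` entrywise nonnegative (while the `W_l^{(x)}`
and `b_l` are arbitrary), every component of the output `z_L` is a convex function of the
input `x`. -/
theorem icfnn_output_convex (nx L : ℕ) (d : ℕ → ℕ)
    (Wz : (l : ℕ) → Matrix (Fin (d (l + 1))) (Fin (d l)) ℝ)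
    (Wx : (l : ℕ) → Matrix (Fin (d (l + 1))) (Fin nx) ℝ)
    (b : (l : ℕ) → Fin (d (l + 1)) → ℝ)
    (g : ℕ → ℝ → ℝ)
    (hg : ∀ l, l < L → ConvexOn ℝ Set.univ (g l) ∧ Monotone (g l))
    (hWz : ∀ l, l < L → ∀ i j, 0 ≤ Wz l i j)
    (hWz0 : Wz 0 = 0)
    (z : (Fin nx → ℝ) → (l : ℕ) → Fin (d l) → ℝ)
    (hz0 : ∀ x, z x 0 = 0)
    (hzrec : ∀ x l, l < L → ∀ j : Fin (d (l + 1)),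
      z x (l + 1) j = g l (((Wz l).mulVec (z x l) + (Wx l).mulVec x + b l) j)) :
    ∀ j : Fin (d L), ConvexOn ℝ Set.univ fun x : Fin nx → ℝ => z x L j := by
  have hconv : ∀ l, l ≤ L → ∀ j, ConvexOn ℝ Set.univ fun x => z x l j := by
    intro l
    induction l with
    | zero =>
      intro _ j
      simp only [hz0]
      exact convexOn_const _ convex_univ
    | succ l ih =>
      intro hl j
      simp only [hzrec _ l hl]
      exact ConvexOn.monotone_comp_univ (hg l hl).1 (hg l hl).2
        (ConvexOn.mulVec_add_affine (hWz l hl) (Wx l) (b l) (ih (Nat.le_of_succ_le hl)) j)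
  exact hconv L le_rfl
end

section
/- Consider an input convex feedforward neural network (ICFNN) defined by the layer recursion z_{l+1} = g_l(W_l^{(z)} z_l + W_l^{(x)} x + b_l) for l = 0, 1, ..., L−1, with z_0 = 0 and W_0^{(z)} = 0, where each g_l : ℝ → ℝ is convex and nondecreasing and is applied componentwise, and where both the matrices W_l^{(z)} and the matrices W_l^{(x)} have all entries nonnegative. Then every component of the output z_L is a convex function of the input x and is nondecreasing in x with respect to the componentwise order (the property required for input convexity under multi-step-ahead prediction). -/
open Matrix

/-- A nonnegative matrix maps a componentwise convex function to one. -/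
theorem convexOn_mulVec_apply {E m n : Type*} [AddCommGroup E] [Module ℝ E] [Fintype n]
    {s : Set E} (hs : Convex ℝ s) {A : Matrix m n ℝ} (hA : ∀ i j, 0 ≤ A i j) {f : E → n → ℝ}
    (hf : ∀ j, ConvexOn ℝ s fun x => f x j) (i : m) :
    ConvexOn ℝ s fun x => (A.mulVec (f x)) i := by
  refine ⟨hs, fun x hx y hy a c ha hc hac => ?_⟩
  simp only [Matrix.mulVec, dotProduct, smul_eq_mul, Finset.mul_sum, ← Finset.sum_add_distrib]
  refine Finset.sum_le_sum fun j _ => ?_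
  have h := mul_le_mul_of_nonneg_left ((hf j).2 hx hy ha hc hac) (hA i j)
  simp only [smul_eq_mul] at h
  linarith

/-- A nonnegative matrix acts monotonically on vectors. -/
theorem monotone_mulVec_of_nonneg {m n : Type*} [Fintype n] {A : Matrix m n ℝ}
    (hA : ∀ i j, 0 ≤ A i j) : Monotone A.mulVec := fun _ _ hxy i =>
  Finset.sum_le_sum fun j _ => mul_le_mul_of_nonneg_left (hxy j) (hA i j)

/-- A convex nondecreasing function composed with a convex function is convex. -/
theorem ConvexOn.comp_of_monotone_univ {E : Type*} [AddCommGroup E] [Module ℝ E] {s : Set E}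
    {g : ℝ → ℝ} {f : E → ℝ} (hg : ConvexOn ℝ Set.univ g) (hmono : Monotone g)
    (hf : ConvexOn ℝ s f) : ConvexOn ℝ s fun x => g (f x) :=
  ⟨hf.1, fun _ hx _ hy _ _ ha hc hac =>
    (hmono (hf.2 hx hy ha hc hac)).trans (hg.2 trivial trivial ha hc hac)⟩

/-- For an ICFNN `z_{l+1} = g_l (W_l^{(z)} z_l + W_l^{(x)} x + b_l)`,
`l = 0, …, L-1`, with `z_0 = 0`, `W_0^{(z)} = 0`, each `g_l` convex and nondecreasing
(applied componentwise), and both the `W_l^{(z)}` and the `W_l^{(x)}` entrywise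
nonnegative, every component of the output `z_L` is a convex and (componentwise)
nondecreasing function of the input `x`. -/
theorem icfnn_output_convex_monotone (nx L : ℕ) (d : ℕ → ℕ)
    (Wz : (l : ℕ) → Matrix (Fin (d (l + 1))) (Fin (d l)) ℝ)
    (Wx : (l : ℕ) → Matrix (Fin (d (l + 1))) (Fin nx) ℝ)
    (b : (l : ℕ) → Fin (d (l + 1)) → ℝ)
    (g : ℕ → ℝ → ℝ)
    (hg : ∀ l, l < L → ConvexOn ℝ Set.univ (g l) ∧ Monotone (g l))
    (hWz : ∀ l, l < L → ∀ i j, 0 ≤ Wz l i j)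
    (hWx : ∀ l, l < L → ∀ i j, 0 ≤ Wx l i j)
    (hWz0 : Wz 0 = 0)
    (z : (Fin nx → ℝ) → (l : ℕ) → Fin (d l) → ℝ)
    (hz0 : ∀ x, z x 0 = 0)
    (hzrec : ∀ x l, l < L → ∀ j : Fin (d (l + 1)),
      z x (l + 1) j = g l (((Wz l).mulVec (z x l) + (Wx l).mulVec x + b l) j)) :
    ∀ j : Fin (d L),
      (ConvexOn ℝ Set.univ fun x : Fin nx → ℝ => z x L j) ∧
      (Monotone fun x : Fin nx → ℝ => z x L j) := by
  suffices H : ∀ l, l ≤ L → ∀ j : Fin (d l),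
      (ConvexOn ℝ Set.univ fun x : Fin nx → ℝ => z x l j) ∧
      (Monotone fun x : Fin nx → ℝ => z x l j) from H L le_rfl
  intro l
  induction l with
  | zero =>
    intro _ j
    simp only [hz0]
    exact ⟨convexOn_const _ convex_univ, monotone_const⟩
  | succ l ih =>
    intro hl j
    have ih := ih (Nat.le_of_succ_le hl)
    obtain ⟨hconv, hmono⟩ := hg l hl
    simp only [hzrec _ l hl, Pi.add_apply]
    constructor
    · refine hconv.comp_of_monotone_univ hmono (ConvexOn.add_const (ConvexOn.add ?_ ?_) (b l j))
      · exact convexOn_mulVec_apply convex_univ (hWz l hl) (fun k => (ih k).1) j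
      · exact convexOn_mulVec_apply convex_univ (hWx l hl)
          (fun k => (LinearMap.proj (R := ℝ) k).convexOn convex_univ) j
    · intro x y hxy
      have hz := monotone_mulVec_of_nonneg (hWz l hl)
        (show z x l ≤ z y l from fun k => (ih k).2 hxy) j
      have hx := monotone_mulVec_of_nonneg (hWx l hl) hxy j
      exact hmono (by gcongr)
end

section
/- Consider an input convex recurrent neural network (ICRNN) defined for inputs x̂_1, ..., x̂_T by h_t = g_1(U x̂_t + W h_{t−1} + D_2 x̂_{t−1}) and y_t = g_2(V h_t + D_1 h_{t−1} + D_3 x̂_t), with h_0 = 0 and x̂_0 = 0, where all weight matrices U, W, V, D_1, D_2, D_3 have nonnegative entries and g_1, g_2 : ℝ → ℝ are convex and nondecreasing, applied componentwise. Then every component of y_t is a convex and nondecreasing (with respect to the componentwise order) function of each input x̂_τ, τ ≤ t, with the other inputs held fixed. -/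
open Matrix

/-- Every component of a vector-valued map is convex and nondecreasing. -/
def ComponentwiseConvexMonotone {E ι : Type*} [AddCommGroup E] [Module ℝ E] [Preorder E]
    (F : E → ι → ℝ) : Prop :=
  ∀ i, ConvexOn ℝ Set.univ (fun v => F v i) ∧ Monotone fun v => F v i

namespace ComponentwiseConvexMonotone

variable {E ι κ : Type*} [AddCommGroup E] [Module ℝ E] [Preorder E]

theorem const (c : ι → ℝ) : ComponentwiseConvexMonotone fun _ : E => c :=
  fun i => ⟨convexOn_const (c i) convex_univ, monotone_const⟩

theorem add {F G : E → ι → ℝ} (hF : ComponentwiseConvexMonotone F)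
    (hG : ComponentwiseConvexMonotone G) :
    ComponentwiseConvexMonotone fun v => F v + G v :=
  fun i => ⟨(hF i).1.add (hG i).1, (hF i).2.add (hG i).2⟩

theorem mulVec [Fintype ι] {F : E → ι → ℝ} (hF : ComponentwiseConvexMonotone F)
    {A : Matrix κ ι ℝ} (hA : ∀ i j, 0 ≤ A i j) :
    ComponentwiseConvexMonotone fun v => A.mulVec (F v) := by
  refine fun i => ⟨⟨convex_univ, fun x _ y _ a b ha hb hab => ?_⟩, fun x y hxy => ?_⟩
  · simp only [Matrix.mulVec, dotProduct, smul_eq_mul, Finset.mul_sum, ← Finset.sum_add_distrib]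
    refine Finset.sum_le_sum fun j _ => ?_
    calc A i j * F (a • x + b • y) j ≤ A i j * (a * F x j + b * F y j) :=
          mul_le_mul_of_nonneg_left
            ((hF j).1.2 (Set.mem_univ x) (Set.mem_univ y) ha hb hab) (hA i j)
      _ = a * (A i j * F x j) + b * (A i j * F y j) := by ring
  · exact Finset.sum_le_sum fun j _ => mul_le_mul_of_nonneg_left ((hF j).2 hxy) (hA i j)

theorem comp_left {F : E → ι → ℝ} (hF : ComponentwiseConvexMonotone F) {g : ℝ → ℝ}
    (hg : ConvexOn ℝ Set.univ g) (hgm : Monotone g) :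
    ComponentwiseConvexMonotone fun v i => g (F v i) := by
  refine fun i => ⟨⟨convex_univ, fun x _ y _ a b ha hb hab => ?_⟩, hgm.comp (hF i).2⟩
  exact (hgm ((hF i).1.2 (Set.mem_univ x) (Set.mem_univ y) ha hb hab)).trans
    (hg.2 (Set.mem_univ _) (Set.mem_univ _) ha hb hab)

theorem update (X : ℕ → ι → ℝ) (τ s : ℕ) :
    ComponentwiseConvexMonotone fun v : ι → ℝ => Function.update X τ v s := by
  by_cases hs : s = τ
  · subst hs
    simp only [Function.update_self]
    exact fun i => ⟨(LinearMap.proj (R := ℝ) (φ := fun _ : ι => ℝ) i).convexOn convex_univ,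
      fun _ _ hxy => hxy i⟩
  · simp only [Function.update_of_ne hs]
    exact const (X s)

end ComponentwiseConvexMonotone

/-- For an ICRNN
`h_t = g₁(U x̂_t + W h_{t−1} + D₂ x̂_{t−1})`, `y_t = g₂(V h_t + D₁ h_{t−1} + D₃ x̂_t)`
with `h₀ = 0`, `x̂₀ = 0`, all weight matrices entrywise nonnegative and `g₁, g₂` convex
and nondecreasing (applied componentwise), every component of `y_t` is a convex and
(componentwise) nondecreasing function of each input `x̂_τ`, `1 ≤ τ ≤ t`, with the other
inputs held fixed. -/
theorem icrnn_output_convex_monotone (ni nh no T : ℕ)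
    (U : Matrix (Fin nh) (Fin ni) ℝ) (W : Matrix (Fin nh) (Fin nh) ℝ)
    (D2 : Matrix (Fin nh) (Fin ni) ℝ)
    (V : Matrix (Fin no) (Fin nh) ℝ) (D1 : Matrix (Fin no) (Fin nh) ℝ)
    (D3 : Matrix (Fin no) (Fin ni) ℝ)
    (g1 g2 : ℝ → ℝ)
    (hU : ∀ i j, 0 ≤ U i j) (hW : ∀ i j, 0 ≤ W i j) (hD2 : ∀ i j, 0 ≤ D2 i j)
    (hV : ∀ i j, 0 ≤ V i j) (hD1 : ∀ i j, 0 ≤ D1 i j) (hD3 : ∀ i j, 0 ≤ D3 i j)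
    (hg1 : ConvexOn ℝ Set.univ g1) (hg1m : Monotone g1)
    (hg2 : ConvexOn ℝ Set.univ g2) (hg2m : Monotone g2)
    (h : (ℕ → Fin ni → ℝ) → ℕ → Fin nh → ℝ)
    (y : (ℕ → Fin ni → ℝ) → ℕ → Fin no → ℝ)
    (hh0 : ∀ X, h X 0 = 0)
    (hhrec : ∀ (X : ℕ → Fin ni → ℝ) (t : ℕ) (j : Fin nh),
      h X (t + 1) j =
        g1 ((U.mulVec (X (t + 1)) + W.mulVec (h X t) + D2.mulVec (X t)) j))
    (hyrec : ∀ (X : ℕ → Fin ni → ℝ) (t : ℕ) (j : Fin no),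
      y X (t + 1) j =
        g2 ((V.mulVec (h X (t + 1)) + D1.mulVec (h X t) + D3.mulVec (X (t + 1))) j)) :
    ∀ X : ℕ → Fin ni → ℝ, X 0 = 0 →
      ∀ t τ : ℕ, 1 ≤ τ → τ ≤ t → t ≤ T → ∀ j : Fin no,
        (ConvexOn ℝ Set.univ fun v : Fin ni → ℝ => y (Function.update X τ v) t j) ∧
        (Monotone fun v : Fin ni → ℝ => y (Function.update X τ v) t j) := by
  intro X _ t τ hτ hτt _ j
  have hidden : ∀ s, ComponentwiseConvexMonotone fun v => h (Function.update X τ v) s := by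
    intro s
    induction s with
    | zero =>
      simp only [hh0]
      exact .const 0
    | succ s ih =>
      have key := ((((ComponentwiseConvexMonotone.update X τ (s + 1)).mulVec hU).add
        (ih.mulVec hW)).add ((ComponentwiseConvexMonotone.update X τ s).mulVec hD2)).comp_left
          hg1 hg1m
      intro i
      simpa only [hhrec] using key i
  obtain ⟨s, rfl⟩ : ∃ s, t = s + 1 := ⟨t - 1, by omega⟩
  have key := ((((hidden (s + 1)).mulVec hV).add ((hidden s).mulVec hD1)).add
    ((ComponentwiseConvexMonotone.update X τ (s + 1)).mulVec hD3)).comp_left hg2 hg2m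
  simp only [hyrec]
  exact key j
end

section
/- Let F : ℝ^{n} × ℝ^{m} → ℝ^{n} be a map each of whose components is jointly convex in (x, u) and nondecreasing in x with respect to the componentwise order on ℝ^n. Fix an initial state x_1 ∈ ℝ^n, and for a control sequence u = (u_1, ..., u_N) ∈ (ℝ^m)^N define recursively x_{k+1} = F(x_k, u_k) for k = 1, ..., N. Then for every k, each component of x_k is a convex function of u ∈ ℝ^{Nm}. -/
/-- If each component of the transition map `F : ℝ^n × ℝ^m → ℝ^n`
is jointly convex in `(x, u)` and nondecreasing in `x` (componentwise order), then along
the trajectory `x_{k+1} = F (x_k, u_k)` starting from a fixed `x₁` (here indexed from `0`,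
i.e. `traj u 0 = x₁`), every component of every state `x_k`, `k ≤ N`, is a convex function
of the control sequence `u = (u_0, …, u_{N-1}) ∈ ℝ^{Nm}`. -/
theorem multistep_prediction_convex {n m N : ℕ}
    (F : (Fin n → ℝ) × (Fin m → ℝ) → Fin n → ℝ)
    (hFconv : ∀ i, ConvexOn ℝ Set.univ fun p : (Fin n → ℝ) × (Fin m → ℝ) => F p i)
    (hFmono : ∀ (u : Fin m → ℝ) (i : Fin n), Monotone fun x : Fin n → ℝ => F (x, u) i)
    (x₁ : Fin n → ℝ)
    (traj : (Fin N → Fin m → ℝ) → ℕ → Fin n → ℝ)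
    (htraj0 : ∀ u, traj u 0 = x₁)
    (htraj : ∀ (u : Fin N → Fin m → ℝ) (k : Fin N),
      traj u (k.val + 1) = F (traj u k.val, u k)) :
    ∀ k : ℕ, k ≤ N → ∀ i : Fin n,
      ConvexOn ℝ Set.univ fun u : Fin N → Fin m → ℝ => traj u k i := by
  intro k
  induction k with
  | zero =>
    intro _ i
    simpa only [htraj0] using convexOn_const (x₁ i) convex_univ
  | succ k ih =>
    intro hk i
    refine ⟨convex_univ, fun u _ v _ a b ha hb hab => ?_⟩
    have hx : traj (a • u + b • v) k ≤ a • traj u k + b • traj v k := fun j =>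
      (ih (Nat.le_of_succ_le hk) j).2 (Set.mem_univ u) (Set.mem_univ v) ha hb hab
    have hstep := fun w => htraj w ⟨k, hk⟩
    simp only at hstep ⊢
    rw [hstep, hstep, hstep]
    exact (hFmono _ i hx).trans
      ((hFconv i).2 (Set.mem_univ (traj u k, u ⟨k, hk⟩)) (Set.mem_univ (traj v k, v ⟨k, hk⟩))
        ha hb hab)
end
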